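/- Let F* ∈ Ω. If there exist λ₁ ≥ 0 and λ₂ ≥ 0 such that for all x ∈ [0, A], λ₁·(x² − P) − λ₂·(ℰ(x) − E_req) + I(F*) − i(x; F*) ≥ 0, with equality for every x in the topological support of F*, then F* is a capacity-achieving input distribution, i.e., I(F*) = C = sup_{F ∈ Ω} I(F). -/

import Mathlib

open MeasureTheory Real Set Filter

/-- Phase-removed Rayleigh-fading channel density `p(y|x)`. -/
noncomputable def pcond (x y : ℝ) : ℝ := (1 / (1 + x ^ 2)) * Real.exp (-y / (1 + x ^ 2))

/-- Modified Bessel function of the first kind, order zero. -/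
noncomputable def besselI0 (t : ℝ) : ℝ := ∑' n : ℕ, (t ^ 2 / 4) ^ n / ((Nat.factorial n : ℝ)) ^ 2

/-- Harvested-energy function `ℰ(x) = I₀(√2 B h₂ x)`. -/
noncomputable def EH (B h2 x : ℝ) : ℝ := besselI0 (Real.sqrt 2 * B * h2 * x)

/-- Output density `p(y; F)`. -/
noncomputable def pout (F : Measure ℝ) (y : ℝ) : ℝ := ∫ x, pcond x y ∂F

/-- Mutual-information density `i(x; F)`. -/
noncomputable def idens (F : Measure ℝ) (x : ℝ) : ℝ :=
  ∫ y in Set.Ioi (0 : ℝ), pcond x y * Real.log (pcond x y / pout F y)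

/-- Mutual information `I(F)`. -/
noncomputable def MI (F : Measure ℝ) : ℝ := ∫ x, idens F x ∂F

/-- Borel probability measure concentrated on `[0, A]`. -/
def IsDistOn (A : ℝ) (F : Measure ℝ) : Prop :=
  IsProbabilityMeasure F ∧ F (Set.Icc 0 A)ᶜ = 0

/-- The feasible set `Ω`: probability measures on `[0,A]` meeting the AP and EH constraints. -/
def Feas (A P B h2 Ereq : ℝ) (F : Measure ℝ) : Prop :=
  IsDistOn A F ∧ (∫ x, x ^ 2 ∂F) ≤ P ∧ Ereq ≤ ∫ x, EH B h2 x ∂F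

/-- Information-energy capacity `C = sup_{F ∈ Ω} I(F)`. -/
noncomputable def Cap (A P B h2 Ereq : ℝ) : ℝ :=
  sSup (MI '' {F | Feas A P B h2 Ereq F})

/-- Topological support of a measure: points all of whose open neighborhoods have
positive measure (the smallest closed set of full measure). -/
def msupp {X : Type*} [TopologicalSpace X] [MeasurableSpace X] (μ : Measure X) : Set X :=
  {x | ∀ U : Set X, IsOpen U → x ∈ U → 0 < μ U}

theorem continuousOn_besselI0 (M : ℝ) : ContinuousOn besselI0 (Set.Icc (-M) M) := by
  unfold besselI0
  refine continuousOn_tsum (u := fun n : ℕ => (M ^ 2 / 4) ^ n / (Nat.factorial n : ℝ))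
    (fun n => by fun_prop) (Real.summable_pow_div_factorial _) ?_
  intro n t ht
  have h1 : t ^ 2 ≤ M ^ 2 := sq_le_sq' ht.1 ht.2
  have h2 : (1 : ℝ) ≤ (Nat.factorial n : ℝ) := by exact_mod_cast Nat.factorial_pos n
  rw [Real.norm_of_nonneg (by positivity)]
  gcongr
  nlinarith

theorem continuous_besselI0 : Continuous besselI0 := by
  rw [continuous_iff_continuousAt]
  intro t
  refine (continuousOn_besselI0 (|t| + 1)).continuousAt (Icc_mem_nhds ?_ ?_)
  · linarith [neg_abs_le t]
  · linarith [le_abs_self t]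

theorem continuous_EH (B h2 : ℝ) : Continuous (EH B h2) := by
  unfold EH
  exact continuous_besselI0.comp (by fun_prop)

theorem IsDistOn.ae_mem {A : ℝ} {F : Measure ℝ} (hF : IsDistOn A F) :
    ∀ᵐ x ∂F, x ∈ Set.Icc 0 A := hF.2

theorem IsDistOn.integrable_of_continuous {A : ℝ} {F : Measure ℝ} (hF : IsDistOn A F)
    {f : ℝ → ℝ} (hf : Continuous f) : Integrable f F := by
  have := hF.1
  have h : IntegrableOn f (Set.Icc 0 A) F := hf.continuousOn.integrableOn_compact isCompact_Icc
  rwa [IntegrableOn, Measure.restrict_eq_self_of_ae_mem hF.ae_mem] at h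

theorem continuous_pcond : Continuous (fun z : ℝ × ℝ => pcond z.1 z.2) := by
  unfold pcond
  have h (z : ℝ × ℝ) : 1 + z.1 ^ 2 ≠ 0 := by positivity
  fun_prop (disch := exact h)

theorem pcond_pos (x y : ℝ) : 0 < pcond x y := by
  unfold pcond
  positivity

theorem pcond_le_exp {A x y : ℝ} (hx : x ∈ Set.Icc 0 A) (hy : 0 ≤ y) :
    pcond x y ≤ Real.exp (-(1 / (1 + A ^ 2)) * y) := by
  have hxA : x ^ 2 ≤ A ^ 2 := pow_le_pow_left₀ hx.1 hx.2 2
  have h1 : 1 / (1 + x ^ 2) ≤ 1 := by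
    rw [div_le_one (by positivity)]
    nlinarith [sq_nonneg x]
  have h2 : 1 / (1 + A ^ 2) ≤ 1 / (1 + x ^ 2) := by gcongr
  have h3 : -y / (1 + x ^ 2) ≤ -(1 / (1 + A ^ 2)) * y := by
    rw [show -y / (1 + x ^ 2) = -(1 / (1 + x ^ 2)) * y by ring]
    nlinarith
  calc pcond x y ≤ 1 * Real.exp (-(1 / (1 + A ^ 2)) * y) := by unfold pcond; gcongr
    _ = _ := one_mul _

theorem pcond_le_one {A x y : ℝ} (hx : x ∈ Set.Icc 0 A) (hy : 0 ≤ y) : pcond x y ≤ 1 := by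
  refine (pcond_le_exp hx hy).trans (Real.exp_le_one_iff.2 ?_)
  have : 0 ≤ 1 / (1 + A ^ 2) := by positivity
  nlinarith

theorem le_pcond {A x y : ℝ} (hx : x ∈ Set.Icc 0 A) (hy : 0 ≤ y) :
    1 / (1 + A ^ 2) * Real.exp (-y) ≤ pcond x y := by
  have hxA : x ^ 2 ≤ A ^ 2 := pow_le_pow_left₀ hx.1 hx.2 2
  have h3 : -y ≤ -y / (1 + x ^ 2) := by
    rw [le_div_iff₀ (by positivity)]
    nlinarith [mul_nonneg hy (sq_nonneg x)]
  unfold pcond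
  gcongr

theorem integrable_pcond {A y : ℝ} {F : Measure ℝ} (hF : IsDistOn A F) :
    Integrable (fun x => pcond x y) F :=
  hF.integrable_of_continuous (continuous_pcond.comp (by fun_prop : Continuous fun x => (x, y)))

theorem pout_le_one {A y : ℝ} {F : Measure ℝ} (hF : IsDistOn A F) (hy : 0 ≤ y) :
    pout F y ≤ 1 := by
  have := hF.1
  have h : pout F y ≤ ∫ _, (1 : ℝ) ∂F := by
    refine integral_mono_ae (integrable_pcond hF) (integrable_const _) ?_
    filter_upwards [hF.ae_mem] with x hx using pcond_le_one hx hy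
  simpa using h

theorem le_pout {A y : ℝ} {F : Measure ℝ} (hF : IsDistOn A F) (hy : 0 ≤ y) :
    1 / (1 + A ^ 2) * Real.exp (-y) ≤ pout F y := by
  have := hF.1
  have h : ∫ _, 1 / (1 + A ^ 2) * Real.exp (-y) ∂F ≤ pout F y := by
    refine integral_mono_ae (integrable_const _) (integrable_pcond hF) ?_
    filter_upwards [hF.ae_mem] with x hx using le_pcond hx hy
  simpa using h

theorem pout_pos {A y : ℝ} {F : Measure ℝ} (hF : IsDistOn A F) (hy : 0 ≤ y) : 0 < pout F y :=
  lt_of_lt_of_le (by positivity) (le_pout hF hy)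

theorem measurable_pout {A : ℝ} {F : Measure ℝ} (hF : IsDistOn A F) : Measurable (pout F) := by
  have := hF.1
  have h : StronglyMeasurable (fun z : ℝ × ℝ => pcond z.2 z.1) :=
    (continuous_pcond.comp continuous_swap).stronglyMeasurable
  exact h.integral_prod_right.measurable

theorem abs_log_le {A y t : ℝ} (ht : 1 / (1 + A ^ 2) * Real.exp (-y) ≤ t) (ht1 : t ≤ 1) :
    |Real.log t| ≤ y + Real.log (1 + A ^ 2) := by
  have hpos : 0 < 1 / (1 + A ^ 2) * Real.exp (-y) := by positivity
  have h := Real.log_le_log hpos ht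
  rw [Real.log_mul (by positivity) (by positivity), Real.log_exp, one_div, Real.log_inv] at h
  have h1 := Real.log_nonpos (hpos.le.trans ht) ht1
  rw [abs_of_nonpos h1]
  linarith

theorem integrableOn_exp_neg_mul {c : ℝ} (hc : 0 < c) :
    IntegrableOn (fun y : ℝ => Real.exp (-c * y)) (Set.Ioi 0) :=
  integrableOn_exp_mul_Ioi (neg_lt_zero.2 hc) 0

theorem integrableOn_mul_exp_neg_mul {c : ℝ} (hc : 0 < c) :
    IntegrableOn (fun y : ℝ => y * Real.exp (-c * y)) (Set.Ioi 0) := by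
  have h := integrableOn_rpow_mul_exp_neg_mul_rpow (s := 1) (p := 1) (by norm_num) one_pos hc
  simpa using h

theorem ae_prod_mem {A : ℝ} {F : Measure ℝ} (hF : IsDistOn A F) :
    ∀ᵐ z : ℝ × ℝ ∂(F.prod (volume.restrict (Set.Ioi 0))), z.1 ∈ Set.Icc 0 A ∧ 0 < z.2 := by
  have := hF.1
  have h1 : ∀ᵐ y : ℝ ∂(volume.restrict (Set.Ioi 0)), 0 < y := ae_restrict_mem measurableSet_Ioi
  exact (Measure.quasiMeasurePreserving_fst.ae hF.ae_mem).and
    (Measure.quasiMeasurePreserving_snd.ae h1)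

theorem integrable_prod_pcond {A : ℝ} {F : Measure ℝ} (hF : IsDistOn A F) :
    Integrable (fun z : ℝ × ℝ => pcond z.1 z.2) (F.prod (volume.restrict (Set.Ioi 0))) := by
  have := hF.1
  have hc : 0 < 1 / (1 + A ^ 2) := by positivity
  refine Integrable.mono' ((integrableOn_exp_neg_mul hc).integrable.comp_snd F)
    continuous_pcond.aestronglyMeasurable ?_
  filter_upwards [ae_prod_mem hF] with z hz
  rw [Real.norm_of_nonneg (pcond_pos _ _).le]
  exact pcond_le_exp hz.1 hz.2.le

theorem integrable_prod_pcond_mul_log {A : ℝ} {F G : Measure ℝ} (hF : IsDistOn A F)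
    (hG : IsDistOn A G) :
    Integrable (fun z : ℝ × ℝ => pcond z.1 z.2 * Real.log (pcond z.1 z.2 / pout G z.2))
      (F.prod (volume.restrict (Set.Ioi 0))) := by
  have := hF.1
  have hc : 0 < 1 / (1 + A ^ 2) := by positivity
  have hb := ((integrableOn_mul_exp_neg_mul hc).integrable.const_mul 2).add
    ((integrableOn_exp_neg_mul hc).integrable.const_mul (2 * Real.log (1 + A ^ 2)))
  have hp : Measurable (fun z : ℝ × ℝ => pcond z.1 z.2) := continuous_pcond.measurable
  refine Integrable.mono' (hb.comp_snd F) (Measurable.aestronglyMeasurable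
    (hp.mul (hp.div ((measurable_pout hG).comp measurable_snd)).log)) ?_
  filter_upwards [ae_prod_mem hF] with z hz
  have h1 := abs_log_le (le_pcond hz.1 hz.2.le) (pcond_le_one hz.1 hz.2.le)
  have h2 := abs_log_le (le_pout hG hz.2.le) (pout_le_one hG hz.2.le)
  have h3 := pcond_le_exp hz.1 hz.2.le
  rw [Real.log_div (pcond_pos _ _).ne' (pout_pos hG hz.2.le).ne', norm_mul,
    Real.norm_of_nonneg (pcond_pos _ _).le, Real.norm_eq_abs]
  calc _ ≤ Real.exp (-(1 / (1 + A ^ 2)) * z.2) * (2 * (z.2 + Real.log (1 + A ^ 2))) := by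
        gcongr
        linarith [abs_sub (Real.log (pcond z.1 z.2)) (Real.log (pout G z.2))]
    _ = _ := by
        simp only [Pi.add_apply]
        ring

theorem integrable_idens {A : ℝ} {F G : Measure ℝ} (hF : IsDistOn A F) (hG : IsDistOn A G) :
    Integrable (idens G) F := by
  have := hF.1
  exact (integrable_prod_pcond_mul_log hF hG).integral_prod_left

theorem integral_pcond (x : ℝ) : ∫ y in Set.Ioi (0 : ℝ), pcond x y = 1 := by
  have hc : -(1 / (1 + x ^ 2)) < 0 := neg_lt_zero.2 (by positivity)
  have h := integral_exp_mul_Ioi hc 0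
  unfold pcond
  rw [integral_const_mul]
  simp_rw [show ∀ y : ℝ, -y / (1 + x ^ 2) = -(1 / (1 + x ^ 2)) * y from fun y => by ring]
  rw [h]
  have : 1 + x ^ 2 ≠ 0 := by positivity
  simp
  field_simp

theorem integrableOn_pout {A : ℝ} {F : Measure ℝ} (hF : IsDistOn A F) :
    IntegrableOn (pout F) (Set.Ioi 0) := by
  have := hF.1
  exact (integrable_prod_pcond hF).integral_prod_right

theorem integral_pout {A : ℝ} {F : Measure ℝ} (hF : IsDistOn A F) :
    ∫ y in Set.Ioi (0 : ℝ), pout F y = 1 := by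
  have := hF.1
  have h := integral_integral_swap (f := pcond) (integrable_prod_pcond hF)
  simp_rw [integral_pcond] at h
  simpa [pout] using h.symm

/-- Mutual information is at most the cross-information with respect to any other input
distribution, by nonnegativity of relative entropy between the output densities. -/
theorem MI_le_integral_idens {A : ℝ} {F G : Measure ℝ} (hF : IsDistOn A F)
    (hG : IsDistOn A G) : MI F ≤ ∫ x, idens G x ∂F := by
  have := hF.1
  have iF := integrable_prod_pcond_mul_log hF hF
  have iG := integrable_prod_pcond_mul_log hF hG
  have eF : MI F = _ := integral_integral_swap iF
  have eG : ∫ x, idens G x ∂F = _ := integral_integral_swap iG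
  rw [← sub_nonneg, eF, eG, ← integral_sub iG.integral_prod_right iF.integral_prod_right]
  have h0 : ∫ y in Set.Ioi (0 : ℝ), (pout F y - pout G y) = 0 := by
    rw [integral_sub (integrableOn_pout hF) (integrableOn_pout hG), integral_pout hF,
      integral_pout hG, sub_self]
  refine h0.symm.le.trans ?_
  refine integral_mono_ae ((integrableOn_pout hF).sub (integrableOn_pout hG))
    (iG.integral_prod_right.sub iF.integral_prod_right) ?_
  filter_upwards [ae_restrict_mem measurableSet_Ioi, iF.prod_left_ae, iG.prod_left_ae]
    with y hy hyF hyG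
  have pF := pout_pos hF (le_of_lt hy)
  have pG := pout_pos hG (le_of_lt hy)
  have key : (∫ x, pcond x y * Real.log (pcond x y / pout G y) ∂F) -
      ∫ x, pcond x y * Real.log (pcond x y / pout F y) ∂F =
      pout F y * (Real.log (pout F y) - Real.log (pout G y)) := by
    rw [← integral_sub hyG hyF, show pout F y = ∫ x, pcond x y ∂F from rfl,
      ← integral_mul_const]
    refine integral_congr_ae (ae_of_all _ fun x => ?_)
    simp only
    rw [← pout, Real.log_div (pcond_pos _ _).ne' pG.ne',
      Real.log_div (pcond_pos _ _).ne' pF.ne']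
    ring
  rw [key]
  have hl := Real.log_le_sub_one_of_pos (div_pos pG pF)
  rw [Real.log_div pG.ne' pF.ne'] at hl
  have hm := mul_le_mul_of_nonneg_left hl pF.le
  rw [mul_sub, mul_sub, mul_div_cancel₀ _ pF.ne'] at hm
  linarith

/-- Sufficient condition for optimality: if `F* ∈ Ω` and there exist
`λ₁, λ₂ ≥ 0` such that for all `x ∈ [0, A]`,
`λ₁(x² − P) − λ₂(ℰ(x) − E_req) + I(F*) − i(x; F*) ≥ 0`,
with equality at every point of the topological support of `F*`, then `F*` is
capacity-achieving: `I(F*) = C = sup_{F ∈ Ω} I(F)`. -/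
theorem stmt3 (A P B h2 Ereq : ℝ) (hA : 0 < A) (hP : 0 < P) (hB : 0 < B) (hh2 : 0 < h2)
    (Fstar : Measure ℝ) (hFstar : Feas A P B h2 Ereq Fstar)
    (l1 l2 : ℝ) (hl1 : 0 ≤ l1) (hl2 : 0 ≤ l2)
    (hineq : ∀ x ∈ Set.Icc (0 : ℝ) A,
      0 ≤ l1 * (x ^ 2 - P) - l2 * (EH B h2 x - Ereq) + MI Fstar - idens Fstar x)
    (heq : ∀ x ∈ msupp Fstar,
      l1 * (x ^ 2 - P) - l2 * (EH B h2 x - Ereq) + MI Fstar - idens Fstar x = 0) :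
    MI Fstar = Cap A P B h2 Ereq := by
  have hgreatest : IsGreatest (MI '' {F | Feas A P B h2 Ereq F}) (MI Fstar) := by
    refine ⟨mem_image_of_mem _ hFstar, ?_⟩
    rintro _ ⟨F, hF, rfl⟩
    obtain ⟨hD, hpow, heh⟩ := hF
    have := hD.1
    have i1 : Integrable (fun x : ℝ => l1 * (x ^ 2 - P)) F :=
      hD.integrable_of_continuous (by fun_prop)
    have i2 : Integrable (fun x : ℝ => l2 * (EH B h2 x - Ereq)) F :=
      hD.integrable_of_continuous (((continuous_EH B h2).sub continuous_const).const_mul l2)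
    have i3 : Integrable (fun x : ℝ => l1 * (x ^ 2 - P) - l2 * (EH B h2 x - Ereq)) F :=
      i1.sub i2
    have hle : ∫ x, idens Fstar x ∂F ≤
        ∫ x, (l1 * (x ^ 2 - P) - l2 * (EH B h2 x - Ereq) + MI Fstar) ∂F := by
      refine integral_mono_ae (integrable_idens hD hFstar.1) (i3.add (integrable_const _)) ?_
      filter_upwards [hD.ae_mem] with x hx
      linarith [hineq x hx]
    rw [integral_add i3 (integrable_const _), integral_sub i1 i2, integral_const_mul,
      integral_const_mul, integral_sub (hD.integrable_of_continuous (by fun_prop))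
        (integrable_const _), integral_sub (hD.integrable_of_continuous (continuous_EH B h2))
        (integrable_const _)] at hle
    simp only [integral_const, probReal_univ, one_smul] at hle
    have h1 := mul_nonneg hl1 (sub_nonneg.2 hpow)
    have h2 := mul_nonneg hl2 (sub_nonneg.2 heh)
    have := MI_le_integral_idens hD hFstar.1
    linarith
  exact hgreatest.csSup_eq.symm
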